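/- There exist constants C''₀, C''₁ > 0, depending only on σ and s, such that if k ≥ C''₀ and I is any oscillation interval of ξ_k, then for each x ∈ I there exists a zero x_{k,i} of ξ_k in I with |x − x_{k,i}| ≤ C''₁ k^{−1/6}. -/

import Mathlib

open MeasureTheory Real Set

/-- The function `q_k(x) = (2k+1+2σ)s − s²x² − σ̄_k x⁻²` with `σ̄_k = σ(σ−(−1)^k)`. -/
noncomputable def qk (σ s : ℝ) (k : ℕ) (x : ℝ) : ℝ :=
  (2 * k + 1 + 2 * σ) * s - s ^ 2 * x ^ 2 - σ * (σ - (-1 : ℝ) ^ k) * (x ^ 2)⁻¹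

/-- `I` is an oscillation interval of `ξ_k`: a maximal open interval on which `q_k`
is defined (i.e. not containing `0` unless `σ̄_k = 0`) and positive. -/
def IsOscInterval (σ s : ℝ) (k : ℕ) (I : Set ℝ) : Prop :=
  I.Nonempty ∧ IsOpen I ∧ I.OrdConnected ∧
    (σ * (σ - (-1 : ℝ) ^ k) = 0 ∨ (0 : ℝ) ∉ I) ∧ (∀ x ∈ I, 0 < qk σ s k x) ∧
    ∀ J : Set ℝ, J.Nonempty → IsOpen J → J.OrdConnected →
      (σ * (σ - (-1 : ℝ) ^ k) = 0 ∨ (0 : ℝ) ∉ J) → (∀ x ∈ J, 0 < qk σ s k x) → I ⊆ J → I = J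

/-- The function `ξ_k = |x|^σ p_k(x) e^{−sx²/2}`. -/
noncomputable def xiF (σ s : ℝ) (p : ℕ → Polynomial ℝ) (k : ℕ) (x : ℝ) : ℝ :=
  |x| ^ σ * ((p k).eval x * Real.exp (-s * x ^ 2 / 2))

open Polynomial

theorem integrable_pow_mul_weight {σ s : ℝ} (hσ : -(1 / 2) < σ) (hs : 0 < s) (n : ℕ) :
    Integrable (fun x : ℝ => x ^ n * (|x| ^ (2 * σ) * Real.exp (-s * x ^ 2))) := by
  have h1 : IntegrableOn (fun x : ℝ => |x| ^ ((n : ℝ) + 2 * σ) * Real.exp (-s * |x| ^ 2))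
      (Ioi 0) := by
    refine (integrableOn_rpow_mul_exp_neg_mul_sq hs (s := (n : ℝ) + 2 * σ) ?_).congr_fun
      (fun x hx => by simp only [abs_of_pos (mem_Ioi.1 hx)]) measurableSet_Ioi
    have : (0 : ℝ) ≤ n := n.cast_nonneg
    linarith
  have h2 : Integrable
      (fun x : ℝ => |x| ^ ((n : ℝ) + 2 * σ) * Real.exp (-s * |x| ^ 2)) := by
    rw [← integrableOn_univ, ← Iio_union_Ici (a := (0 : ℝ)), integrableOn_union,
      integrableOn_Ici_iff_integrableOn_Ioi]
    refine ⟨?_, h1⟩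
    rw [← neg_zero] at h1
    simpa only [abs_neg] using h1.comp_neg_Iio
  refine h2.mono' (by fun_prop) ?_
  have h0 : ∀ᵐ x : ℝ, x ≠ 0 := by
    simp [ae_iff, measure_singleton]
  filter_upwards [h0] with x hx
  rw [norm_mul, norm_pow, Real.norm_eq_abs, Real.norm_of_nonneg (by positivity),
    Real.rpow_add (abs_pos.2 hx), Real.rpow_natCast, sq_abs, mul_assoc]

theorem integrable_eval_mul_weight {σ s : ℝ} (hσ : -(1 / 2) < σ) (hs : 0 < s) (f : ℝ[X]) :
    Integrable (fun x : ℝ => f.eval x * (|x| ^ (2 * σ) * Real.exp (-s * x ^ 2))) := by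
  induction f using Polynomial.induction_on' with
  | add f g hf hg => simp only [eval_add, add_mul]; exact hf.add hg
  | monomial n a =>
    simpa [mul_assoc] using (integrable_pow_mul_weight hσ hs n).const_mul a

/-- Integration of polynomials against `|x|^{2σ} e^{-s x²}`, as a linear functional. -/
noncomputable def weightIntegral {σ s : ℝ} (hσ : -(1 / 2) < σ) (hs : 0 < s) : ℝ[X] →ₗ[ℝ] ℝ where
  toFun f := ∫ x : ℝ, f.eval x * (|x| ^ (2 * σ) * Real.exp (-s * x ^ 2))
  map_add' f g := by
    simp only [eval_add, add_mul]
    exact integral_add (integrable_eval_mul_weight hσ hs f) (integrable_eval_mul_weight hσ hs g)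
  map_smul' c f := by
    simp only [eval_smul, smul_eq_mul, mul_assoc, integral_const_mul, RingHom.id_apply]

theorem weightIntegral_X_pow_odd {σ s : ℝ} (hσ : -(1 / 2) < σ) (hs : 0 < s) {n : ℕ}
    (hn : Odd n) : weightIntegral hσ hs (X ^ n) = 0 := by
  have h := integral_neg_eq_self
    (fun x : ℝ => x ^ n * (|x| ^ (2 * σ) * Real.exp (-s * x ^ 2))) volume
  simp only [hn.neg_pow, abs_neg, even_two.neg_pow, neg_mul, integral_neg] at h
  simp only [weightIntegral, LinearMap.coe_mk, AddHom.coe_mk, eval_pow, eval_X, neg_mul]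
  linarith

theorem weightIntegral_X_pow_even {σ s : ℝ} (hσ : -(1 / 2) < σ) (hs : 0 < s) {n : ℕ}
    (hn : Even n) : weightIntegral hσ hs (X ^ n) =
      s ^ (-((n : ℝ) + 2 * σ + 1) / 2) * Real.Gamma (((n : ℝ) + 2 * σ + 1) / 2) := by
  have hn0 : (0 : ℝ) ≤ n := n.cast_nonneg
  have h1 : weightIntegral hσ hs (X ^ n) =
      ∫ x : ℝ, (fun x : ℝ => x ^ n * (x ^ (2 * σ) * Real.exp (-s * x ^ 2))) |x| := by
    simp only [weightIntegral, LinearMap.coe_mk, AddHom.coe_mk, eval_pow, eval_X, sq_abs,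
      hn.pow_abs]
  have h2 : ∫ x in Ioi (0 : ℝ), x ^ n * (x ^ (2 * σ) * Real.exp (-s * x ^ 2)) =
      ∫ x in Ioi (0 : ℝ), x ^ ((n : ℝ) + 2 * σ) * Real.exp (-s * x ^ (2 : ℝ)) := by
    refine setIntegral_congr_fun measurableSet_Ioi fun x hx => ?_
    have hx : (0 : ℝ) < x := hx
    simp only [Real.rpow_add hx, Real.rpow_natCast, Real.rpow_two, mul_assoc]
  rw [h1, integral_comp_abs (f := fun x : ℝ => x ^ n * (x ^ (2 * σ) * Real.exp (-s * x ^ 2))), h2,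
    integral_rpow_mul_exp_neg_mul_rpow (by norm_num) (by linarith) hs]
  ring

theorem weightIntegral_X_pow_add_two {σ s : ℝ} (hσ : -(1 / 2) < σ) (hs : 0 < s) {n : ℕ}
    (hn : Even n) : 2 * s * weightIntegral hσ hs (X ^ (n + 2)) =
      (n + 1 + 2 * σ) * weightIntegral hσ hs (X ^ n) := by
  have hn0 : (0 : ℝ) ≤ n := n.cast_nonneg
  rw [weightIntegral_X_pow_even hσ hs hn, weightIntegral_X_pow_even hσ hs (hn.add even_two)]
  push_cast
  rw [show ((n : ℝ) + 2 + 2 * σ + 1) / 2 = ((n : ℝ) + 2 * σ + 1) / 2 + 1 by ring,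
    show -((n : ℝ) + 2 + 2 * σ + 1) / 2 = -((n : ℝ) + 2 * σ + 1) / 2 - 1 by ring,
    Real.Gamma_add_one (by linarith), Real.rpow_sub_one hs.ne']
  field_simp
  ring

/-- The second order operator `f ↦ T² f - 2 s x f'`, where `T` is the Dunkl operator with
parameter `σ`. -/
noncomputable def dunklHermite (σ s : ℝ) : ℝ[X] →ₗ[ℝ] ℝ[X] :=
  Polynomial.lsum fun n : ℕ =>
    (((n : ℝ) + σ * (1 - (-1) ^ n)) * ((n : ℝ) - 1 + σ * (1 + (-1) ^ n))) • monomial (n - 2)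
      - (2 * s * n) • monomial n

theorem dunklHermite_monomial (σ s : ℝ) (n : ℕ) (a : ℝ) :
    dunklHermite σ s (monomial n a) =
      monomial (n - 2)
        (((n : ℝ) + σ * (1 - (-1) ^ n)) * ((n : ℝ) - 1 + σ * (1 + (-1) ^ n)) * a)
      - monomial n (2 * s * n * a) := by
  simp [dunklHermite, smul_monomial]

theorem dunklHermite_coeff (σ s : ℝ) (f : ℝ[X]) (n : ℕ) :
    (dunklHermite σ s f).coeff n =
      ((n : ℝ) + 2 + σ * (1 - (-1) ^ n)) * ((n : ℝ) + 1 + σ * (1 + (-1) ^ n)) * f.coeff (n + 2)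
        - 2 * s * n * f.coeff n := by
  induction f using Polynomial.induction_on' with
  | add f g hf hg => simp only [map_add, coeff_add, hf, hg]; ring
  | monomial m a =>
    rw [dunklHermite_monomial, coeff_sub, coeff_monomial, coeff_monomial, coeff_monomial,
      coeff_monomial]
    rcases m with _ | _ | m
    · by_cases h : 0 = n <;> simp [h]
      subst h; simp
    · have h1 : (0 + 1 - 2 = n) ↔ n = 0 := by omega
      have h2 : ¬ (0 + 1 = n + 2) := by omega
      by_cases h : 0 + 1 = n
      · subst h; simp
      · simp [h]
    · have h1 : (m + 1 + 1 - 2 = n) ↔ m = n := by omega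
      have h2 : (m + 1 + 1 = n + 2) ↔ m = n := by omega
      simp only [h1, h2]
      congr 1
      · by_cases h : m = n
        · subst h
          simp only [if_true]
          push_cast
          ring
        · simp [h]
      · by_cases h : m + 1 + 1 = n
        · subst h; simp
        · simp [h]

theorem dunklHermite_eval (σ s : ℝ) (f : ℝ[X]) (x : ℝ) :
    x ^ 2 * (dunklHermite σ s f).eval x =
      x ^ 2 * (derivative (derivative f)).eval x + 2 * σ * x * (derivative f).eval x
        - σ * (f.eval x - f.eval (-x)) - 2 * s * x ^ 3 * (derivative f).eval x := by
  induction f using Polynomial.induction_on' with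
  | add f g hf hg =>
    simp only [map_add, eval_add, mul_add, hf, hg]; ring
  | monomial m a =>
    rw [dunklHermite_monomial]
    rcases m with _ | _ | m
    · simp
    · simp
      ring
    · simp only [eval_sub, eval_monomial, derivative_monomial, neg_pow x]
      have h1 : m + 1 + 1 - 2 = m := by omega
      have h2 : m + 1 + 1 - 1 = m + 1 := by omega
      have h3 : m + 1 - 1 = m := by omega
      rw [h1, h2, h3]
      rcases neg_one_pow_eq_or ℝ m with h | h
      all_goals
        push_cast
        simp only [pow_succ, h]
        ring

theorem weightIntegral_dunklHermite_X_pow_even {σ s : ℝ} (hσ : -(1 / 2) < σ) (hs : 0 < s)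
    {a b : ℕ} (hab : Even (a + b)) :
    ((a : ℝ) + σ * (1 - (-1) ^ a)) * ((a : ℝ) - 1 + σ * (1 + (-1) ^ a)) *
        weightIntegral hσ hs (X ^ (a - 2 + b)) - 2 * s * a * weightIntegral hσ hs (X ^ (a + b)) =
      -((a : ℝ) * b + σ * (1 - (-1) ^ a)) * weightIntegral hσ hs (X ^ (a + b - 2)) := by
  rcases a with _ | _ | a
  · simp
  · obtain ⟨c, rfl⟩ : ∃ c, b = c + 1 :=
      Nat.exists_eq_succ_of_ne_zero (by rintro rfl; simp at hab)
    have hc : Even c := by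
      have : c + 2 = 0 + 1 + (c + 1) := by ring
      rw [← this, Nat.even_add] at hab
      exact hab.2 even_two
    have h := weightIntegral_X_pow_add_two hσ hs hc
    rw [show 0 + 1 + (c + 1) = c + 2 by ring, show c + 2 - 2 = c by omega]
    push_cast
    linear_combination -h
  · rw [show a + 1 + 1 - 2 + b = a + b by omega, show a + 1 + 1 + b = a + b + 2 by ring,
      show a + b + 2 - 2 = a + b by omega]
    have hc : Even (a + b) := by
      rw [show a + 1 + 1 + b = a + b + 2 by ring, Nat.even_add] at hab
      exact hab.2 even_two
    have h := weightIntegral_X_pow_add_two hσ hs hc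
    rw [pow_succ, pow_succ]
    push_cast at h ⊢
    rcases neg_one_pow_eq_or ℝ a with h1 | h1 <;> rw [h1] <;>
      linear_combination (-(a : ℝ) - 2) * h

theorem weightIntegral_dunklHermite_X_pow_odd {σ s : ℝ} (hσ : -(1 / 2) < σ) (hs : 0 < s)
    {a b : ℕ} (hab : Odd (a + b)) :
    ((a : ℝ) + σ * (1 - (-1) ^ a)) * ((a : ℝ) - 1 + σ * (1 + (-1) ^ a)) *
        weightIntegral hσ hs (X ^ (a - 2 + b)) - 2 * s * a * weightIntegral hσ hs (X ^ (a + b)) =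
      0 := by
  rw [weightIntegral_X_pow_odd hσ hs hab]
  rcases a with _ | _ | a
  · simp
  · simp
  · have h : Odd (a + b) := by
      obtain ⟨c, hc⟩ := hab
      exact ⟨c - 1, by omega⟩
    rw [show a + 1 + 1 - 2 + b = a + b by omega, weightIntegral_X_pow_odd hσ hs h]
    ring

theorem weightIntegral_dunklHermite_mul {σ s : ℝ} (hσ : -(1 / 2) < σ) (hs : 0 < s)
    (f g : ℝ[X]) :
    weightIntegral hσ hs (dunklHermite σ s f * g) =
      weightIntegral hσ hs (f * dunklHermite σ s g) := by
  induction f using Polynomial.induction_on' with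
  | add f₁ f₂ h₁ h₂ => simp only [map_add, add_mul, h₁, h₂]
  | monomial a u =>
  induction g using Polynomial.induction_on' with
  | add g₁ g₂ h₁ h₂ => simp only [map_add, mul_add, h₁, h₂]
  | monomial b v =>
  have key : ∀ (n : ℕ) (c : ℝ),
      weightIntegral hσ hs (monomial n c) = c * weightIntegral hσ hs (X ^ n) := by
    intro n c
    rw [← C_mul_X_pow_eq_monomial, ← smul_eq_C_mul, map_smul, smul_eq_mul]
  simp only [dunklHermite_monomial, sub_mul, mul_sub, map_sub, monomial_mul_monomial, key]
  rcases Nat.even_or_odd (a + b) with hab | hab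
  · have h1 := weightIntegral_dunklHermite_X_pow_even hσ hs hab
    have h2 := weightIntegral_dunklHermite_X_pow_even hσ hs ((add_comm a b) ▸ hab)
    have h3 : (-1 : ℝ) ^ a = (-1) ^ b := neg_one_pow_congr (Nat.even_add.1 hab)
    rw [add_comm b a, add_comm (b - 2) a, ← h3] at h2
    rw [← h3]
    linear_combination u * v * (h1 - h2)
  · have h1 := weightIntegral_dunklHermite_X_pow_odd hσ hs hab
    have h2 := weightIntegral_dunklHermite_X_pow_odd hσ hs ((add_comm a b) ▸ hab)
    rw [add_comm b a, add_comm (b - 2) a] at h2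
    linear_combination u * v * (h1 - h2)

section orthonormal

variable {k : ℕ} {p : ℕ → ℝ[X]} {Λ : ℝ[X] →ₗ[ℝ] ℝ}

theorem exists_sub_smul_coeff_eq_zero (hdeg : ∀ k, (p k).degree = k) {n : ℕ} {q : ℝ[X]}
    (hq : q.degree < (n + 1 : ℕ)) : ∃ c : ℝ, (q - c • p n).degree < n ∧ q.coeff n =
      c * (p n).coeff n := by
  have hlead : (p n).coeff n ≠ 0 := coeff_ne_zero_of_eq_degree (hdeg n)
  refine ⟨q.coeff n / (p n).coeff n, ?_, by field_simp⟩
  rw [degree_lt_iff_coeff_zero] at hq ⊢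
  intro m hm
  rcases hm.eq_or_lt with rfl | hm
  · simp [hlead]
  · rw [coeff_sub, coeff_smul, hq m hm, coeff_eq_zero_of_degree_lt (n := m)]
    · simp
    · rw [hdeg]; exact_mod_cast hm

theorem orthogonal_of_degree_lt (hdeg : ∀ k, (p k).degree = k)
    (horth : ∀ k l, Λ (p k * p l) = if k = l then 1 else 0) {q : ℝ[X]} (hq : q.degree < k) :
    Λ (q * p k) = 0 := by
  have key : ∀ n ≤ k, ∀ q : ℝ[X], q.degree < n → Λ (q * p k) = 0 := by
    intro n
    induction n with
    | zero =>
      intro _ q hq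
      have : q = 0 := by
        ext m
        exact (degree_lt_iff_coeff_zero q 0).1 hq m m.zero_le
      simp [this]
    | succ n ih =>
      intro hn q hq
      obtain ⟨c, hc, -⟩ := exists_sub_smul_coeff_eq_zero hdeg hq
      have h := ih (by omega) _ hc
      rw [sub_mul, map_sub, smul_mul_assoc, map_smul, horth, if_neg (by omega)] at h
      simpa using h
  exact key k le_rfl q hq

theorem eq_zero_of_orthogonal (hdeg : ∀ k, (p k).degree = k)
    (horth : ∀ k l, Λ (p k * p l) = if k = l then 1 else 0) {r : ℝ[X]} (hr : r.degree < k)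
    (h : ∀ l < k, Λ (r * p l) = 0) : r = 0 := by
  by_contra hr0
  have hd : r.degree < (r.natDegree + 1 : ℕ) := by
    rw [degree_eq_natDegree hr0]
    exact_mod_cast Nat.lt_succ_self _
  have hk : r.natDegree < k := (natDegree_lt_iff_degree_lt hr0).2 hr
  obtain ⟨c, hc, hc'⟩ := exists_sub_smul_coeff_eq_zero hdeg hd
  have h1 := orthogonal_of_degree_lt hdeg horth hc
  rw [sub_mul, map_sub, h _ hk, smul_mul_assoc, map_smul, horth, if_pos rfl] at h1
  have : c = 0 := by simpa using h1
  rw [this, zero_mul] at hc'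
  exact hr0 (leadingCoeff_eq_zero.1 hc')

end orthonormal

/-- The generalized Hermite polynomials are eigenvectors of `dunklHermite`. -/
theorem dunklHermite_eq_smul {σ s : ℝ} (hσ : -(1 / 2) < σ) (hs : 0 < s) {p : ℕ → ℝ[X]}
    (hdeg : ∀ k, (p k).degree = k)
    (horth : ∀ k l, weightIntegral hσ hs (p k * p l) = if k = l then 1 else 0) (k : ℕ) :
    dunklHermite σ s (p k) = (-(2 * s * k)) • p k := by
  have hlt : ∀ {q : ℝ[X]} {n : ℕ}, q.degree < n → (dunklHermite σ s q).degree < n := by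
    intro q n hq
    rw [degree_lt_iff_coeff_zero] at hq ⊢
    intro m hm
    rw [dunklHermite_coeff, hq m hm, hq (m + 2) (by omega)]
    ring
  have hp : ∀ m, k < m → (p k).coeff m = 0 := fun m hm =>
    coeff_eq_zero_of_degree_lt (by rw [hdeg]; exact_mod_cast hm)
  rw [← sub_eq_zero]
  refine eq_zero_of_orthogonal (k := k) hdeg horth ?_ fun l hl => ?_
  · rw [degree_lt_iff_coeff_zero]
    intro m hm
    rw [coeff_sub, dunklHermite_coeff, coeff_smul, hp (m + 2) (by omega)]
    rcases hm.eq_or_lt with rfl | hm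
    · simp
    · simp [hp m hm]
  · have hl' : (p l).degree < k := by rw [hdeg]; exact_mod_cast hl
    rw [sub_mul, map_sub, weightIntegral_dunklHermite_mul, smul_mul_assoc, map_smul, horth,
      if_neg hl.ne', mul_comm, orthogonal_of_degree_lt hdeg horth (hlt hl')]
    simp

theorem eval_neg_of_eigenvector {σ s : ℝ} (hs : 0 < s) {f : ℝ[X]} {k : ℕ} (hf : f.degree = k)
    (h : dunklHermite σ s f = (-(2 * s * k)) • f) (x : ℝ) :
    f.eval (-x) = (-1) ^ k * f.eval x := by
  have hcoeff : ∀ j n : ℕ, k < n + 2 * j → Odd (n + k) → f.coeff n = 0 := by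
    intro j
    induction j with
    | zero =>
      intro n hn _
      exact coeff_eq_zero_of_degree_lt (by rw [hf]; exact_mod_cast hn)
    | succ j ih =>
      intro n hn hodd
      have h1 : f.coeff (n + 2) = 0 :=
        ih (n + 2) (by omega) (by rw [add_right_comm]; exact hodd.add_even even_two)
      have h2 := congrArg (coeff · n) h
      simp only [dunklHermite_coeff, h1, coeff_smul, smul_eq_mul] at h2
      have h3 : (n : ℝ) - k ≠ 0 := by
        rw [sub_ne_zero]
        intro h4
        have : n = k := by exact_mod_cast h4
        subst this
        exact (Nat.not_even_iff_odd.2 hodd) ⟨n, rfl⟩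
      have h4 : (2 * s * ((n : ℝ) - k)) * f.coeff n = 0 := by linear_combination -h2
      exact (mul_eq_zero.1 h4).resolve_left (by positivity)
  rw [eval_eq_sum_range, eval_eq_sum_range, Finset.mul_sum]
  refine Finset.sum_congr rfl fun n _ => ?_
  rcases Nat.even_or_odd (n + k) with hn | hn
  · rw [neg_pow, neg_one_pow_congr (Nat.even_add.1 hn)]
    ring
  · rw [hcoeff (k + 1) n (by omega) hn]
    simp

/-- On the positive half-line, `x^σ p(x) e^{-s x²/2}` solves `f'' = -q_k f`. -/
theorem hasDerivAt_hermiteFunction (σ s : ℝ) (f : ℝ[X]) {x : ℝ} (hx : 0 < x) :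
    HasDerivAt (fun x => x ^ σ * Real.exp (-s * x ^ 2 / 2) * f.eval x)
      (x ^ σ * Real.exp (-s * x ^ 2 / 2) *
        ((σ / x - s * x) * f.eval x + (derivative f).eval x)) x := by
  have h1 : HasDerivAt (fun x : ℝ => x ^ σ) (σ * x ^ (σ - 1)) x :=
    Real.hasDerivAt_rpow_const (Or.inl hx.ne')
  have h2 : HasDerivAt (fun x : ℝ => -s * x ^ 2 / 2) (-s * x) x := by
    have := ((hasDerivAt_pow 2 x).const_mul (-s)).div_const 2
    refine this.congr_deriv ?_
    norm_num
    ring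
  refine ((h1.mul h2.exp).mul (f.hasDerivAt x)).congr_deriv ?_
  rw [Real.rpow_sub_one hx.ne']
  simp only [Pi.mul_apply]
  field_simp
  ring

theorem hasDerivAt_deriv_hermiteFunction {σ s : ℝ} (hs : 0 < s) {f : ℝ[X]} {k : ℕ}
    (hf : f.degree = k) (h : dunklHermite σ s f = (-(2 * s * k)) • f) {x : ℝ} (hx : 0 < x) :
    HasDerivAt (fun x => x ^ σ * Real.exp (-s * x ^ 2 / 2) *
        ((σ / x - s * x) * f.eval x + (derivative f).eval x))
      (-qk σ s k x * (x ^ σ * Real.exp (-s * x ^ 2 / 2) * f.eval x)) x := by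
  have h1 := hasDerivAt_hermiteFunction σ s f hx
  have h2 := hasDerivAt_hermiteFunction σ s (derivative f) hx
  have h3 : HasDerivAt (fun x : ℝ => σ / x - s * x) (-σ / x ^ 2 - s) x := by
    have := ((hasDerivAt_inv hx.ne').const_mul σ).sub ((hasDerivAt_id x).const_mul s)
    refine this.congr_deriv ?_
    field_simp
  have h4 : x ^ 2 * (-(2 * s * k) * f.eval x) =
      x ^ 2 * (derivative (derivative f)).eval x + 2 * σ * x * (derivative f).eval x
        - σ * (f.eval x - (-1) ^ k * f.eval x) - 2 * s * x ^ 3 * (derivative f).eval x := by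
    have := dunklHermite_eval σ s f x
    rwa [h, eval_smul, smul_eq_mul, eval_neg_of_eigenvector hs hf h] at this
  have h5 := (h3.mul h1).add h2
  have h6 : (fun x => x ^ σ * Real.exp (-s * x ^ 2 / 2) *
        ((σ / x - s * x) * f.eval x + (derivative f).eval x)) =
      ((fun x : ℝ => σ / x - s * x) * (fun x => x ^ σ * Real.exp (-s * x ^ 2 / 2) * f.eval x)) +
        fun x => x ^ σ * Real.exp (-s * x ^ 2 / 2) * (derivative f).eval x := by
    funext y
    simp only [Pi.add_apply, Pi.mul_apply]
    ring
  rw [h6]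
  refine h5.congr_deriv ?_
  have h7 : (derivative (derivative f)).eval x = -(2 * s * k) * f.eval x -
      2 * σ / x * (derivative f).eval x + σ * (1 - (-1) ^ k) / x ^ 2 * f.eval x
        + 2 * s * x * (derivative f).eval x := by
    field_simp
    linear_combination -h4
  rw [h7, qk]
  field_simp
  ring

/-- Sturm comparison with a constant coefficient. -/
theorem exists_zero_of_sturm {f f' q : ℝ → ℝ} {a m : ℝ} (hm : 0 < m)
    (hf : ∀ x ∈ Icc a (a + π / m), HasDerivAt f (f' x) x)
    (hf' : ∀ x ∈ Icc a (a + π / m), HasDerivAt f' (-q x * f x) x)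
    (hq : ∀ x ∈ Icc a (a + π / m), m ^ 2 ≤ q x) :
    ∃ x ∈ Icc a (a + π / m), f x = 0 := by
  have hpos : ∀ (f f' : ℝ → ℝ), (∀ x ∈ Icc a (a + π / m), HasDerivAt f (f' x) x) →
      (∀ x ∈ Icc a (a + π / m), HasDerivAt f' (-q x * f x) x) →
      ¬ ∀ x ∈ Icc a (a + π / m), 0 < f x := by
    intro f f' hf hf' hpos
    have hab : a ≤ a + π / m := by have := Real.pi_pos; have : 0 ≤ π / m := by positivity
                                   linarith
    have hW : ∀ x ∈ Icc a (a + π / m),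
        HasDerivAt (fun x => f' x * Real.sin (m * (x - a)) - f x * (m * Real.cos (m * (x - a))))
          ((m ^ 2 - q x) * f x * Real.sin (m * (x - a))) x := by
      intro x hx
      have h0 : HasDerivAt (fun x => m * (x - a)) m x := by
        simpa using ((hasDerivAt_id x).sub_const a).const_mul m
      have := ((hf' x hx).mul h0.sin).sub ((hf x hx).mul (h0.cos.const_mul m))
      exact this.congr_deriv (by ring)
    have hanti : AntitoneOn
        (fun x => f' x * Real.sin (m * (x - a)) - f x * (m * Real.cos (m * (x - a))))
        (Icc a (a + π / m)) := by
      refine antitoneOn_of_hasDerivWithinAt_nonpos (convex_Icc _ _)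
        (fun x hx => (hW x hx).continuousAt.continuousWithinAt)
        (fun x hx => (hW x (interior_subset hx)).hasDerivWithinAt) fun x hx => ?_
      have hx := interior_subset hx
      have h1 : 0 ≤ Real.sin (m * (x - a)) := by
        refine Real.sin_nonneg_of_nonneg_of_le_pi (mul_nonneg hm.le (by linarith [hx.1])) ?_
        have := hx.2
        calc m * (x - a) ≤ m * (π / m) := by gcongr; linarith
          _ = π := by field_simp
      exact mul_nonpos_of_nonpos_of_nonneg
        (mul_nonpos_of_nonpos_of_nonneg (by linarith [hq x hx]) (hpos x hx).le) h1
    have h := hanti (left_mem_Icc.2 hab) (right_mem_Icc.2 hab) hab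
    have e1 : m * (a + π / m - a) = π := by field_simp; simp
    simp only [e1, sub_self, mul_zero, Real.sin_zero, Real.sin_pi, Real.cos_zero,
      Real.cos_pi] at h
    have h1 := mul_pos (hpos _ (left_mem_Icc.2 hab)) hm
    have h2 := mul_pos (hpos _ (right_mem_Icc.2 hab)) hm
    linarith
  by_contra! hne
  have hcont : ContinuousOn f (Icc a (a + π / m)) :=
    fun x hx => (hf x hx).continuousAt.continuousWithinAt
  have hab : a ≤ a + π / m := by have := Real.pi_pos; have : 0 ≤ π / m := by positivity
                                 linarith
  rcases lt_or_gt_of_ne (hne a (left_mem_Icc.2 hab)) with h | h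
  · refine hpos (fun x => -f x) (fun x => -f' x) (fun x hx => (hf x hx).neg)
      (fun x hx => by exact (hf' x hx).neg.congr_deriv (by ring)) fun x hx => ?_
    by_contra! hx0
    obtain ⟨y, hy, hy0⟩ := (isPreconnected_Icc).intermediate_value (left_mem_Icc.2 hab) hx hcont
      (show (0 : ℝ) ∈ Icc (f a) (f x) from ⟨h.le, by linarith⟩)
    exact hne y hy hy0
  · refine hpos f f' hf hf' fun x hx => ?_
    by_contra! hx0
    obtain ⟨y, hy, hy0⟩ := (isPreconnected_Icc).intermediate_value hx (left_mem_Icc.2 hab) hcont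
      (show (0 : ℝ) ∈ Icc (f x) (f a) from ⟨hx0, h.le⟩)
    exact hne y hy hy0

section turningPoint

variable {A s τ T t x : ℝ}

/-- Moving right from a point far from the outer turning point. -/
theorem potential_right (hs : 0 < s) (ht : 1 ≤ t) (hτ : |τ| ≤ T) (hA : 2 * s * t ^ 6 ≤ A)
    (ht₁ : 2 * (8 * s ^ 2 + T) ≤ s * t ^ 4) (ht₂ : 2 * π ^ 2 ≤ s * t ^ 4) (hx : 0 ≤ x)
    (hxA : 4 * s ^ 2 * x ^ 2 ≤ A) (hq : 0 < A - s ^ 2 * x ^ 2 - τ * (x ^ 2)⁻¹)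
    (hx0 : τ = 0 ∨ x ≠ 0) :
    (∀ y ∈ Icc (x + 1 / t) (x + 2 / t), (π * t) ^ 2 ≤ A - s ^ 2 * y ^ 2 - τ * (y ^ 2)⁻¹) ∧
      ∀ z ∈ Icc x (x + 2 / t), 0 < A - s ^ 2 * z ^ 2 - τ * (z ^ 2)⁻¹ := by
  have ht0 : 0 < t := by linarith
  have hT : 0 ≤ T := (abs_nonneg τ).trans hτ
  have ht2 : 1 ≤ t ^ 2 := one_le_pow₀ ht
  have hs2 : 0 < s ^ 2 := by positivity
  have h46 : s * t ^ 4 * t ^ 2 ≤ A / 2 := by linarith [hA, show s * t ^ 4 * t ^ 2 = s * t ^ 6 by ring]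
  have h4A : s * t ^ 4 ≤ A / 2 := le_trans (le_mul_of_one_le_right (by positivity) ht2) h46
  have hδ : (2 / t) ≤ 2 := by rw [div_le_iff₀ ht0]; linarith
  have hsq : ∀ y, 0 ≤ y → y ≤ x + 2 / t → s ^ 2 * y ^ 2 ≤ A / 2 + 8 * s ^ 2 := by
    intro y hy0 hy
    have h1 : y ^ 2 ≤ 2 * x ^ 2 + 8 := by nlinarith [sq_nonneg (x - 2)]
    nlinarith
  constructor
  · rintro y ⟨hy1, hy2⟩
    have hδ0 : 0 < 1 / t := by positivity
    have hy : 1 / t ≤ y := by linarith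
    have hy0 : 0 < y := by linarith
    have h1 := hsq y hy0.le hy2
    have h2 : (y ^ 2)⁻¹ ≤ t ^ 2 := by
      rw [← inv_pow]
      gcongr
      rw [inv_le_comm₀ hy0 ht0, ← one_div]
      exact hy
    have h3 : τ * (y ^ 2)⁻¹ ≤ T * t ^ 2 := by
      have : 0 ≤ (y ^ 2)⁻¹ := by positivity
      exact mul_le_mul ((le_abs_self τ).trans hτ) h2 this hT
    have h4 : (8 * s ^ 2 + T) * t ^ 2 ≤ A / 4 := by nlinarith
    have h5 : π ^ 2 * t ^ 2 ≤ A / 4 := by nlinarith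
    have h6 : 8 * s ^ 2 ≤ 8 * s ^ 2 * t ^ 2 := le_mul_of_one_le_right (by positivity) ht2
    rw [mul_pow]
    linarith
  · rintro z ⟨hz1, hz2⟩
    have h1 := hsq z (by linarith) hz2
    rcases hx.eq_or_lt with rfl | hx
    · have : τ = 0 := hx0.resolve_right (by simp)
      subst this
      have h2 : z ^ 2 ≤ 4 := by nlinarith
      nlinarith
    · have hz : 0 < z := by linarith
      have h2 : 0 < x ^ 2 * (A - s ^ 2 * x ^ 2 - τ * (x ^ 2)⁻¹) := by positivity
      have h3 : x ^ 2 * (A - s ^ 2 * x ^ 2 - τ * (x ^ 2)⁻¹) =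
          A * x ^ 2 - s ^ 2 * x ^ 4 - τ := by field_simp
      have h4 : A - s ^ 2 * z ^ 2 - τ * (z ^ 2)⁻¹ =
          (A * z ^ 2 - s ^ 2 * z ^ 4 - τ) / z ^ 2 := by field_simp
      rw [h4]
      refine div_pos ?_ (by positivity)
      rw [h3] at h2
      have h5 : 0 ≤ z ^ 2 - x ^ 2 := by nlinarith
      have h6 : 0 ≤ A - s ^ 2 * (z ^ 2 + x ^ 2) := by nlinarith
      nlinarith [mul_nonneg h5 h6]

/-- Moving left from a point far from the inner turning point. -/
theorem potential_left {D r : ℝ} (hs : 0 < s) (ht : 1 ≤ t) (hτ : |τ| ≤ T)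
    (hA : 2 * s * t ^ 6 ≤ A) (ht₁ : 32 * T ≤ t ^ 4) (hr : 0 < r) (hr2 : r ^ 2 = 2 * s)
    (hD : 1 ≤ D) (hDr : 2 * r * π ^ 2 ≤ D * s ^ 2) (ht₂ : 4 * D * r ≤ t ^ 3) (hx : 0 < x)
    (hxA : A ≤ 4 * s ^ 2 * x ^ 2) (hq : 0 < A - s ^ 2 * x ^ 2 - τ * (x ^ 2)⁻¹) :
    0 < x - 2 * D / t ∧
    (∀ y ∈ Icc (x - 2 * D / t) (x - D / t),
      (π * t / D) ^ 2 ≤ A - s ^ 2 * y ^ 2 - τ * (y ^ 2)⁻¹) ∧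
      ∀ z ∈ Icc (x - 2 * D / t) x, 0 < A - s ^ 2 * z ^ 2 - τ * (z ^ 2)⁻¹ := by
  have ht0 : 0 < t := by linarith
  have hD0 : 0 < D := by linarith
  have hT : 0 ≤ T := (abs_nonneg τ).trans hτ
  have hx1 : t ^ 6 ≤ 2 * s * x ^ 2 := by
    have h1 : 2 * s * t ^ 6 ≤ 2 * s * (2 * s * x ^ 2) := by nlinarith
    exact le_of_mul_le_mul_left h1 (by positivity)
  have hx2 : t ^ 3 ≤ r * x := by
    refine abs_le_of_sq_le_sq' ?_ (by positivity) |>.2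
    rw [mul_pow, hr2]
    linarith [show (t ^ 3) ^ 2 = t ^ 6 by ring]
  have hδ : 2 * D / t ≤ x / 2 := by
    have h1 : 4 * D ≤ x := by
      refine le_of_mul_le_mul_left (a := r) ?_ hr
      linarith
    have h2 : 2 * D / t ≤ 2 * D := div_le_self (by positivity) ht
    linarith
  have hdiff : ∀ z ∈ Icc (x - 2 * D / t) x,
      (x ^ 2 - z ^ 2) * (s ^ 2 / 2) < A - s ^ 2 * z ^ 2 - τ * (z ^ 2)⁻¹ := by
    rintro z ⟨hz1, hz2⟩
    have hz : x / 2 ≤ z := by linarith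
    have hz0 : 0 < z := by linarith
    have h1 : A - s ^ 2 * z ^ 2 - τ * (z ^ 2)⁻¹ = (A - s ^ 2 * x ^ 2 - τ * (x ^ 2)⁻¹) +
        (x ^ 2 - z ^ 2) * (s ^ 2 - τ / (x ^ 2 * z ^ 2)) := by
      field_simp
      ring
    have h2 : τ / (x ^ 2 * z ^ 2) ≤ s ^ 2 / 2 := by
      rw [div_le_iff₀ (by positivity)]
      have h3 : x ^ 2 / 4 ≤ z ^ 2 := by nlinarith
      have h4 : x ^ 2 * (x ^ 2 / 4) ≤ x ^ 2 * z ^ 2 := by gcongr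
      have h5 : (t ^ 6) ^ 2 ≤ (2 * s * x ^ 2) ^ 2 := by gcongr
      have h6 : t ^ 4 ≤ (t ^ 6) ^ 2 := by
        rw [← pow_mul]
        exact pow_le_pow_right₀ ht (by norm_num)
      have h7 : s ^ 2 / 2 * (x ^ 2 * (x ^ 2 / 4)) ≤ s ^ 2 / 2 * (x ^ 2 * z ^ 2) := by gcongr
      nlinarith [le_abs_self τ]
    have h3 : 0 ≤ x ^ 2 - z ^ 2 := by nlinarith
    have h4 : (x ^ 2 - z ^ 2) * (s ^ 2 / 2) ≤ (x ^ 2 - z ^ 2) * (s ^ 2 - τ / (x ^ 2 * z ^ 2)) :=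
      mul_le_mul_of_nonneg_left (by linarith) h3
    linarith
  refine ⟨by linarith, fun y hy => ?_, fun z hz => ?_⟩
  · have hDt : 0 < D / t := by positivity
    have hy' : y ∈ Icc (x - 2 * D / t) x := ⟨hy.1, by linarith [hy.2]⟩
    have hy0 : 0 < y := by linarith [hy.1]
    refine le_trans ?_ (hdiff y hy').le
    have h1 : D / t * x ≤ x ^ 2 - y ^ 2 := by nlinarith [hy.2, hy'.2]
    have h2 : D / t * (t ^ 3 / r) ≤ D / t * x := by
      gcongr
      rw [div_le_iff₀ hr]
      linarith
    have h3 : (π * t / D) ^ 2 ≤ D / t * (t ^ 3 / r) * (s ^ 2 / 2) := by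
      have e : D / t * (t ^ 3 / r) * (s ^ 2 / 2) = (D * s ^ 2) * t ^ 2 / (2 * r) := by
        field_simp
      rw [e, le_div_iff₀ (by positivity)]
      calc (π * t / D) ^ 2 * (2 * r) ≤ (π * t) ^ 2 * (2 * r) := by
            gcongr
            exact div_le_self (by positivity) hD
        _ = (2 * r * π ^ 2) * t ^ 2 := by ring
        _ ≤ _ := by gcongr
    refine h3.trans ?_
    gcongr
    exact h2.trans h1
  · refine lt_of_le_of_lt ?_ (hdiff z hz)
    have : 0 ≤ x ^ 2 - z ^ 2 := by nlinarith [hz.1, hz.2]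
    positivity

end turningPoint

/-- The open set where `qk` is defined and positive. -/
def posSet (σ s : ℝ) (k : ℕ) : Set ℝ :=
  {x | (σ * (σ - (-1 : ℝ) ^ k) = 0 ∨ x ≠ 0) ∧ 0 < qk σ s k x}

theorem exists_zero_near_of_nonneg {σ s : ℝ} (hσ : -(1 / 2) < σ) (hs : 0 < s) {p : ℕ → ℝ[X]}
    (hdeg : ∀ k, (p k).degree = k)
    (heig : ∀ k, dunklHermite σ s (p k) = (-(2 * s * k)) • p k) :
    ∃ C₀ > (0 : ℝ), ∃ C₁ > (0 : ℝ), ∀ k : ℕ, C₀ ≤ (k : ℝ) → ∀ x ∈ posSet σ s k, 0 ≤ x →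
      ∃ y, (p k).eval y = 0 ∧ uIcc x y ⊆ posSet σ s k ∧
        |x - y| ≤ C₁ * (k : ℝ) ^ (-(1 / 6) : ℝ) := by
  set T : ℝ := |σ| * (|σ| + 1) with hT
  set r : ℝ := Real.sqrt (2 * s) with hr
  set D : ℝ := 1 + 2 * r * π ^ 2 / s ^ 2 with hD
  set K : ℝ := 1 + 2 * (8 * s ^ 2 + T) / s + 2 * π ^ 2 / s + 32 * T + 4 * D * r with hK
  have hπ := Real.pi_pos
  have hr0 : 0 < r := Real.sqrt_pos.2 (by positivity)
  have hr2 : r ^ 2 = 2 * s := Real.sq_sqrt (by positivity)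
  have hT0 : 0 ≤ T := by positivity
  have hD1 : 1 ≤ D := by
    have : 0 ≤ 2 * r * π ^ 2 / s ^ 2 := by positivity
    linarith
  have hD0 : 0 < D := by linarith
  have hDr : 2 * r * π ^ 2 ≤ D * s ^ 2 := by
    have : D * s ^ 2 = s ^ 2 + 2 * r * π ^ 2 := by rw [hD]; field_simp
    rw [this]
    linarith [sq_nonneg s]
  have e1 : 0 ≤ 2 * (8 * s ^ 2 + T) / s := by positivity
  have e2 : 0 ≤ 2 * π ^ 2 / s := by positivity
  have e3 : 0 ≤ 4 * D * r := by positivity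
  have hK0 : 0 < K := by linarith
  refine ⟨K ^ 6, by positivity, 2 * D, by positivity, fun k hk x hx hx0 => ?_⟩
  have hk0 : (0 : ℝ) < k := lt_of_lt_of_le (by positivity) hk
  set t : ℝ := (k : ℝ) ^ (1 / 6 : ℝ) with ht
  have ht0 : 0 < t := by positivity
  have ht6 : t ^ 6 = k := by
    rw [ht, ← Real.rpow_natCast, ← Real.rpow_mul hk0.le]
    norm_num
  have htinv : (k : ℝ) ^ (-(1 / 6) : ℝ) = 1 / t := by
    rw [Real.rpow_neg hk0.le, one_div t]
  have hKt : K ≤ t := by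
    refine le_of_pow_le_pow_left₀ (n := 6) (by norm_num) ht0.le ?_
    rwa [ht6]
  have ht1 : 1 ≤ t := by linarith
  have ht4 : t ≤ t ^ 4 := le_self_pow₀ ht1 (by norm_num)
  have ht3 : t ≤ t ^ 3 := le_self_pow₀ ht1 (by norm_num)
  set τ : ℝ := σ * (σ - (-1 : ℝ) ^ k) with hτ
  set A : ℝ := (2 * k + 1 + 2 * σ) * s with hA
  have hAt : 2 * s * t ^ 6 ≤ A := by
    have : 0 ≤ (1 + 2 * σ) * s := mul_nonneg (by linarith) hs.le
    rw [ht6, hA]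
    linarith
  have hτT : |τ| ≤ T := by
    rw [hτ, hT, abs_mul]
    gcongr
    refine (abs_sub _ _).trans ?_
    simp
  have hqk : ∀ y, qk σ s k y = A - s ^ 2 * y ^ 2 - τ * (y ^ 2)⁻¹ := fun y => rfl
  have hT1 : 2 * (8 * s ^ 2 + T) ≤ s * t ^ 4 := by
    have : 2 * (8 * s ^ 2 + T) / s ≤ t ^ 4 := by linarith
    rw [div_le_iff₀ hs] at this
    linarith
  have hT2 : 2 * π ^ 2 ≤ s * t ^ 4 := by
    have : 2 * π ^ 2 / s ≤ t ^ 4 := by linarith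
    rw [div_le_iff₀ hs] at this
    linarith
  obtain ⟨hx1, hq⟩ := hx
  rw [hqk] at hq
  have hsturm : ∀ c m : ℝ, 0 < c → 0 < m → (∀ y ∈ Icc c (c + π / m), m ^ 2 ≤ qk σ s k y) →
      ∃ y ∈ Icc c (c + π / m), (p k).eval y = 0 := by
    intro c m hc hm h
    obtain ⟨y, hy, hy0⟩ := exists_zero_of_sturm hm
      (fun y hy => hasDerivAt_hermiteFunction σ s (p k) (hc.trans_le hy.1))
      (fun y hy => hasDerivAt_deriv_hermiteFunction hs (hdeg k) (heig k) (hc.trans_le hy.1)) h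
    have : 0 < y := hc.trans_le hy.1
    exact ⟨y, hy, (mul_eq_zero.1 hy0).resolve_left (by positivity)⟩
  rw [htinv]
  rcases le_total (4 * s ^ 2 * x ^ 2) A with hxA | hxA
  · obtain ⟨h1, h2⟩ := potential_right hs ht1 hτT hAt hT1 hT2 hx0 hxA hq hx1
    have e : x + 1 / t + π / (π * t) = x + 2 / t := by field_simp; ring
    have hδ : 0 < 1 / t := by positivity
    obtain ⟨y, hy, hy0⟩ := hsturm (x + 1 / t) (π * t) (by positivity) (by positivity)
      (by rw [e]; exact h1)
    rw [e] at hy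
    have hxy : x ≤ y := by linarith [hy.1]
    refine ⟨y, hy0, fun z hz => ?_, ?_⟩
    · rw [uIcc_of_le hxy] at hz
      refine ⟨?_, h2 z ⟨hz.1, hz.2.trans hy.2⟩⟩
      refine hx1.imp_right fun h => ?_
      have : 0 < x := lt_of_le_of_ne hx0 h.symm
      exact (this.trans_le hz.1).ne'
    · rw [abs_sub_comm, abs_of_nonneg (by linarith)]
      have h3 : 2 / t = 2 * (1 / t) := by ring
      have h4 : 2 * (1 / t) ≤ 2 * D * (1 / t) :=
        mul_le_mul_of_nonneg_right (by linarith) hδ.le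
      linarith [hy.2]
  · have hx0 : 0 < x := by
      refine lt_of_le_of_ne hx0 fun h => ?_
      have : 0 < A := lt_of_lt_of_le (by positivity) hAt
      rw [← h] at hxA
      norm_num at hxA
      linarith
    obtain ⟨h0, h1, h2⟩ := potential_left hs ht1 hτT hAt (by linarith) hr0 hr2 hD1 hDr
      (by linarith) hx0 hxA hq
    have e : x - 2 * D / t + π / (π * t / D) = x - D / t := by field_simp; ring
    have hδ : 0 < D / t := by positivity
    obtain ⟨y, hy, hy0⟩ := hsturm (x - 2 * D / t) (π * t / D) h0 (by positivity)
      (by rw [e]; exact h1)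
    rw [e] at hy
    have hxy : y ≤ x := by linarith [hy.2]
    refine ⟨y, hy0, fun z hz => ?_, ?_⟩
    · rw [uIcc_of_ge hxy] at hz
      exact ⟨Or.inr (h0.trans_le (hy.1.trans hz.1)).ne', h2 z ⟨hy.1.trans hz.1, hz.2⟩⟩
    · rw [abs_of_nonneg (by linarith)]
      have : 2 * D / t = 2 * D * (1 / t) := by ring
      linarith [hy.1]

theorem isOpen_posSet (σ s : ℝ) (k : ℕ) : IsOpen (posSet σ s k) := by
  by_cases h : σ * (σ - (-1 : ℝ) ^ k) = 0
  · have : posSet σ s k = {x | 0 < (2 * k + 1 + 2 * σ) * s - s ^ 2 * x ^ 2} := by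
      ext x
      simp [posSet, qk, h]
    rw [this]
    exact isOpen_lt continuous_const (by fun_prop)
  · have : posSet σ s k = {0}ᶜ ∩ qk σ s k ⁻¹' Ioi 0 := by
      ext x
      simp [posSet, h]
    rw [this]
    refine ContinuousOn.isOpen_inter_preimage ?_ isOpen_compl_singleton isOpen_Ioi
    unfold qk
    refine ContinuousOn.sub (by fun_prop) (continuousOn_const.mul ?_)
    exact (continuous_pow 2).continuousOn.inv₀ fun x hx => pow_ne_zero 2 hx

theorem IsOscInterval.uIcc_subset {σ s : ℝ} {k : ℕ} {I : Set ℝ} (hI : IsOscInterval σ s k I)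
    {x y : ℝ} (hx : x ∈ I) (hxy : uIcc x y ⊆ posSet σ s k) : y ∈ I := by
  obtain ⟨-, -, hord, h0, hpos, hmax⟩ := hI
  have hIsub : I ⊆ posSet σ s k := fun z hz =>
    ⟨h0.imp_right fun h hz0 => h (hz0 ▸ hz), hpos z hz⟩
  have hsub := connectedComponentIn_subset (posSet σ s k) x
  have hpre : IsPreconnected (connectedComponentIn (posSet σ s k) x) :=
    isPreconnected_connectedComponentIn
  have h := hmax (connectedComponentIn (posSet σ s k) x)
    ⟨x, mem_connectedComponentIn (hIsub hx)⟩ (isOpen_posSet σ s k).connectedComponentIn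
    hpre.ordConnected (or_iff_not_imp_left.2 fun hτ h => (hsub h).1.elim hτ fun h => h rfl)
    (fun z hz => (hsub hz).2)
    (hord.isPreconnected.subset_connectedComponentIn hx hIsub)
  rw [h]
  exact isPreconnected_uIcc.subset_connectedComponentIn left_mem_uIcc hxy right_mem_uIcc

theorem neg_mem_posSet {σ s : ℝ} {k : ℕ} {x : ℝ} (hx : x ∈ posSet σ s k) :
    -x ∈ posSet σ s k := by
  simpa [posSet, qk] using hx

theorem distribution_of_zeros (σ s : ℝ) (hσ : -(1/2) < σ) (hs : 0 < s)
    (p : ℕ → Polynomial ℝ)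
    (hdeg : ∀ k, (p k).degree = k)
    (hlead : ∀ k, 0 < (p k).leadingCoeff)
    (horth : ∀ k l, (∫ x : ℝ,
        (p k).eval x * (p l).eval x * |x| ^ (2 * σ) * Real.exp (-s * x ^ 2)) =
        if k = l then 1 else 0) :
    ∃ C₀ > (0 : ℝ), ∃ C₁ > (0 : ℝ), ∀ k : ℕ, C₀ ≤ (k : ℝ) →
      ∀ I : Set ℝ, IsOscInterval σ s k I → ∀ x ∈ I,
        ∃ y ∈ I, xiF σ s p k y = 0 ∧ |x - y| ≤ C₁ * (k : ℝ) ^ (-(1/6) : ℝ) := by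
  have horth' : ∀ k l, weightIntegral hσ hs (p k * p l) = if k = l then 1 else 0 := by
    intro k l
    rw [← horth k l]
    simp only [weightIntegral, LinearMap.coe_mk, AddHom.coe_mk, eval_mul, mul_assoc]
  have heig := dunklHermite_eq_smul hσ hs hdeg horth'
  obtain ⟨C₀, hC₀, C₁, hC₁, h⟩ := exists_zero_near_of_nonneg hσ hs hdeg heig
  refine ⟨C₀, hC₀, C₁, hC₁, fun k hk I hI x hx => ?_⟩
  have hxpos : x ∈ posSet σ s k :=
    ⟨hI.2.2.2.1.imp_right fun h hz0 => h (hz0 ▸ hx), hI.2.2.2.2.1 x hx⟩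
  rcases le_total 0 x with hx0 | hx0
  · obtain ⟨y, hy0, hxy, hdist⟩ := h k hk x hxpos hx0
    exact ⟨y, hI.uIcc_subset hx hxy, by simp [xiF, hy0], hdist⟩
  · obtain ⟨y, hy0, hxy, hdist⟩ := h k hk (-x) (neg_mem_posSet hxpos) (by linarith)
    refine ⟨-y, hI.uIcc_subset hx fun z hz => ?_, ?_, ?_⟩
    · rw [← neg_neg z]
      refine neg_mem_posSet (hxy ?_)
      rw [mem_uIcc] at hz ⊢
      rcases hz with hz | hz
      · exact Or.inr ⟨by linarith, by linarith⟩
      · exact Or.inl ⟨by linarith, by linarith⟩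
    · simp [xiF, eval_neg_of_eigenvector hs (hdeg k) (heig k), hy0]
    · rwa [← abs_neg, show -(x - -y) = -x - y by ring]
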